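/- Let n ≥ 1, let L > 0, let α > 0, and let f : ℝ^n → ℝ be convex, differentiable, and L-smooth relative to h(x) = Σ_i x_i log x_i on S. Let I ⊆ {1,...,n} be nonempty and set S_I = {x ∈ S : x_i = 0 for all i ∉ I}. Let x^k ∈ S_I with x^k_i > 0 for all i ∈ I, and let x^{k+1} be the minimizer over S_I of the function z ↦ ⟨∇f(x^k), z⟩ + (1/α) D(z, x^k). Then for every x ∈ S_I: α (f(x^{k+1}) - f(x)) ≤ D(x, x^k) - D(x, x^{k+1}) - (1 - αL) D(x^{k+1}, x^k). -/

import Mathlib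

open Finset Filter Topology

noncomputable def klS (a b : ℝ) : ℝ := if a = 0 then b else a * Real.log (a / b) - a + b

noncomputable def kl {n : ℕ} (x y : Fin n → ℝ) : ℝ := ∑ i, klS (x i) (y i)

def probSimplex (n : ℕ) : Set (Fin n → ℝ) := {x | (∑ i, x i) = 1 ∧ ∀ i, 0 ≤ x i}

noncomputable def suppF {n : ℕ} (x : Fin n → ℝ) : Finset (Fin n) :=
  Finset.univ.filter (fun i => x i ≠ 0)

noncomputable def l0 {n : ℕ} (x : Fin n → ℝ) : ℕ := (suppF x).card

theorem klS_eq (a b : ℝ) : klS a b = a * Real.log (a / b) - a + b := by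
  unfold klS
  split_ifs with h <;> simp [h]

theorem klS_eq_mul_klFun (a : ℝ) {b : ℝ} (hb : b ≠ 0) :
    klS a b = b * InformationTheory.klFun (a / b) := by
  rw [klS_eq, InformationTheory.klFun]
  field_simp
  ring

theorem klS_nonneg {a b : ℝ} (ha : 0 ≤ a) (hb : 0 < b) : 0 ≤ klS a b := by
  rw [klS_eq_mul_klFun a hb.ne']
  exact mul_nonneg hb.le (InformationTheory.klFun_nonneg (div_nonneg ha hb.le))

theorem klS_eq_zero_iff {a b : ℝ} (ha : 0 ≤ a) (hb : 0 < b) : klS a b = 0 ↔ a = b := by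
  rw [klS_eq_mul_klFun a hb.ne', mul_eq_zero, or_iff_right hb.ne',
    InformationTheory.klFun_eq_zero_iff (div_nonneg ha hb.le), div_eq_one_iff_eq hb.ne']

theorem klS_self {a : ℝ} (ha : 0 ≤ a) : klS a a = 0 := by
  rcases ha.eq_or_lt with rfl | h
  · simp [klS]
  · exact (klS_eq_zero_iff h.le h).2 rfl

/-- A nonpositive divergence between vectors supported in `I` forces equality when the second
vector is positive on `I`. -/
theorem eq_of_kl_nonpos {n : ℕ} {I : Finset (Fin n)} {x y : Fin n → ℝ}
    (hx : ∀ i, 0 ≤ x i) (hxI : ∀ i ∉ I, x i = 0) (hyI : ∀ i ∉ I, y i = 0)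
    (hy : ∀ i ∈ I, 0 < y i) (h : kl x y ≤ 0) : x = y := by
  have hnn : ∀ i ∈ univ, 0 ≤ klS (x i) (y i) := by
    intro i _
    by_cases hi : i ∈ I
    · exact klS_nonneg (hx i) (hy i hi)
    · simp [hxI i hi, hyI i hi, klS]
  have h0 := (sum_eq_zero_iff_of_nonneg hnn).1 (le_antisymm h (sum_nonneg hnn))
  funext i
  by_cases hi : i ∈ I
  · exact (klS_eq_zero_iff (hx i) (hy i hi)).1 (h0 i (mem_univ i))
  · rw [hxI i hi, hyI i hi]

theorem kl_self {n : ℕ} {x : Fin n → ℝ} (hx : ∀ i, 0 ≤ x i) : kl x x = 0 :=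
  sum_eq_zero fun i _ => klS_self (hx i)

/-- Exponential tilting: the entropic proximal objective is a divergence from the normalized
multiplicative-weights vector, up to a constant. -/
theorem exists_kl_tilt {n : ℕ} {I : Finset (Fin n)} (hI : I.Nonempty) {w : Fin n → ℝ}
    (hw : w ∈ probSimplex n) (hwI : ∀ i ∉ I, w i = 0) (hwpos : ∀ i ∈ I, 0 < w i)
    (u : (Fin n → ℝ) →ₗ[ℝ] ℝ) :
    ∃ y ∈ probSimplex n, (∀ i ∉ I, y i = 0) ∧ (∀ i ∈ I, 0 < y i) ∧
      ∃ c, ∀ z ∈ probSimplex n, (∀ i ∉ I, z i = 0) → kl z y = u z + kl z w + c := by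
  set g : Fin n → ℝ := fun i => u (Pi.single i 1) with hg
  set Z : ℝ := ∑ i, w i * Real.exp (-g i) with hZ
  have hZpos : 0 < Z := by
    obtain ⟨j, hj⟩ := hI
    exact sum_pos' (fun i _ => mul_nonneg (hw.2 i) (Real.exp_pos _).le)
      ⟨j, mem_univ j, mul_pos (hwpos j hj) (Real.exp_pos _)⟩
  have hysum : ∑ i, w i * Real.exp (-g i) / Z = 1 := by
    rw [← sum_div, ← hZ, div_self hZpos.ne']
  refine ⟨fun i => w i * Real.exp (-g i) / Z, ⟨hysum, fun i => ?_⟩, fun i hi => ?_,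
    fun i hi => ?_, Real.log Z, fun z hz hzI => ?_⟩
  · exact div_nonneg (mul_nonneg (hw.2 i) (Real.exp_pos _).le) hZpos.le
  · simp [hwI i hi]
  · exact div_pos (mul_pos (hwpos i hi) (Real.exp_pos _)) hZpos
  · have hu : u z = ∑ i, z i * g i := by
      rw [LinearMap.pi_apply_eq_sum_univ u z]
      refine sum_congr rfl fun i _ => ?_
      rw [smul_eq_mul, hg]
      congr 2
      funext j
      simp [Pi.single_apply, eq_comm]
    have hterm : ∀ i, klS (z i) (w i * Real.exp (-g i) / Z) =
        z i * g i + klS (z i) (w i) + z i * Real.log Z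
          + (w i * Real.exp (-g i) / Z - w i) := by
      intro i
      rw [klS_eq, klS_eq]
      by_cases hi : i ∈ I
      · rcases (hz.2 i).eq_or_lt with h | h
        · simp [← h]
        · have hwi := hwpos i hi
          rw [Real.log_div h.ne' (by positivity), Real.log_div (by positivity) hZpos.ne',
            Real.log_mul hwi.ne' (by positivity), Real.log_exp, Real.log_div h.ne' hwi.ne']
          ring
      · simp [hzI i hi]
    unfold kl
    rw [sum_congr rfl fun i _ => hterm i, sum_add_distrib, sum_add_distrib, sum_add_distrib,
      sum_sub_distrib, ← sum_mul, hysum, hw.1, hz.1, hu]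
    ring

/-- The gradient inequality for a differentiable convex function. -/
theorem ConvexOn.add_fderiv_le {E : Type*} [NormedAddCommGroup E] [NormedSpace ℝ E] {f : E → ℝ}
    (hconv : ConvexOn ℝ Set.univ f) {w : E} (hf : DifferentiableAt ℝ f w) (x : E) :
    f w + fderiv ℝ f w (x - w) ≤ f x := by
  have hline : HasDerivAt (fun t : ℝ => f (AffineMap.lineMap w x t)) (fderiv ℝ f w (x - w)) 0 := by
    refine HasFDerivAt.comp_hasDerivAt (0 : ℝ) ?_ AffineMap.hasDerivAt_lineMap
    simpa using hf.hasFDerivAt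
  have hc : ConvexOn ℝ Set.univ (fun t : ℝ => f (AffineMap.lineMap w x t)) :=
    hconv.comp_affineMap (AffineMap.lineMap w x)
  have := hc.le_slope_of_hasDerivAt (Set.mem_univ 0) (Set.mem_univ 1) one_pos hline
  simp only [slope_def_field, AffineMap.lineMap_apply_zero, AffineMap.lineMap_apply_one, sub_zero,
    div_one] at this
  linarith

/-- the fundamental Bregman proximal gradient inequality on the
support-restricted simplex. -/
theorem stmt_8 (n : ℕ) (hn : 1 ≤ n) (L α : ℝ) (hL : 0 < L) (hα : 0 < α)
    (f : (Fin n → ℝ) → ℝ) (hconv : ConvexOn ℝ Set.univ f) (hf : Differentiable ℝ f)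
    (hsmooth : ∀ z ∈ probSimplex n, ∀ w ∈ probSimplex n, suppF z ⊆ suppF w →
      f z ≤ f w + fderiv ℝ f w (z - w) + L * kl z w)
    (I : Finset (Fin n)) (hI : I.Nonempty)
    (xk : Fin n → ℝ) (hxk : xk ∈ probSimplex n) (hxkI : ∀ i ∉ I, xk i = 0)
    (hxkpos : ∀ i ∈ I, 0 < xk i)
    (xk1 : Fin n → ℝ) (hxk1 : xk1 ∈ probSimplex n) (hxk1I : ∀ i ∉ I, xk1 i = 0)
    (hmin : ∀ z ∈ probSimplex n, (∀ i ∉ I, z i = 0) →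
      fderiv ℝ f xk xk1 + (1 / α) * kl xk1 xk ≤ fderiv ℝ f xk z + (1 / α) * kl z xk) :
    ∀ x ∈ probSimplex n, (∀ i ∉ I, x i = 0) →
      α * (f xk1 - f x) ≤ kl x xk - kl x xk1 - (1 - α * L) * kl xk1 xk := by
  intro x hx hxI
  obtain ⟨y, hy, hyI, hypos, c, htilt⟩ :=
    exists_kl_tilt hI hxk hxkI hxkpos (α • (fderiv ℝ f xk).toLinearMap)
  simp only [LinearMap.smul_apply, ContinuousLinearMap.coe_coe, smul_eq_mul] at htilt
  have h1 := htilt xk1 hxk1 hxk1I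
  have hle : kl xk1 y ≤ 0 := by
    have h2 := htilt y hy hyI
    have h3 := mul_le_mul_of_nonneg_left (hmin y hy hyI) hα.le
    rw [mul_add, mul_add, ← mul_assoc, ← mul_assoc, mul_one_div_cancel hα.ne', one_mul,
      one_mul] at h3
    rw [kl_self hy.2] at h2
    linarith
  obtain rfl := eq_of_kl_nonpos hxk1.2 hxk1I hyI hypos hle
  rw [kl_self hxk1.2] at h1
  have h2 := htilt x hx hxI
  have hsupp : suppF xk1 ⊆ suppF xk := by
    intro i hi
    simp only [suppF, mem_filter, mem_univ, true_and] at hi ⊢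
    exact (hxkpos i (not_imp_comm.1 (hxk1I i) hi)).ne'
  have h3 := hsmooth xk1 hxk1 xk hxk hsupp
  have h4 := hconv.add_fderiv_le (hf xk) x
  rw [map_sub] at h3 h4
  have h5 : f xk1 - f x ≤ fderiv ℝ f xk xk1 - fderiv ℝ f xk x + L * kl xk1 xk := by linarith
  have h6 := mul_le_mul_of_nonneg_left h5 hα.le
  linarith
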